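/- Let n ≥ 3 be an integer with n ≠ 4, and assume θ_n ∈ [α_n, γ_n) satisfies F(θ_n) = 0. For θ ∈ [θ_n, β_n) and either choice of sign, set x = x_±, z = z_±, y = 2cos θ, C = x²*z - x*y - z, and D = x*z - y - 1. Then D² - C² > 0. -/

import Mathlib

open Real

/-- The left endpoint `α_n` of the interval considered for the `(-2,3,2n+1)`-pretzel knot. -/
noncomputable def alphaN (n : ℕ) : ℝ :=
  if n % 3 = 0 then 2 * π / 3 - π / (6 * (n : ℝ) + 15)
  else if n % 3 = 1 then 2 * π / 3 + π / (6 * (n : ℝ) - 3)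
  else 2 * π / 3 - π / (2 * (n : ℝ) + 5)

/-- The right endpoint `β_n` of the interval considered for the `(-2,3,2n+1)`-pretzel knot. -/
noncomputable def betaN (n : ℕ) : ℝ :=
  if n % 3 = 0 then 2 * π / 3 + π / (6 * (n : ℝ) + 3)
  else if n % 3 = 1 then 2 * π / 3 + π / (2 * (n : ℝ) + 1)
  else 2 * π / 3 - π / (6 * (n : ℝ) + 3)

/-- The interior point `γ_n ∈ (α_n, β_n)`. -/
noncomputable def gammaN (n : ℕ) : ℝ :=
  if n % 3 = 0 then 2 * π / 3
  else if n % 3 = 1 then 2 * π / 3 + 4 * π / (12 * (n : ℝ) + 9)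
  else 2 * π / 3 - 4 * π / (12 * (n : ℝ) + 9)

/-- `F θ = 2 cos ((n+1)θ) cos (3θ/2) - cos ((2n+1)θ/2)`. -/
noncomputable def FN (n : ℕ) (θ : ℝ) : ℝ :=
  2 * Real.cos (((n : ℝ) + 1) * θ) * Real.cos (3 * θ / 2)
    - Real.cos ((2 * (n : ℝ) + 1) * θ / 2)

/-- `r = (S (n-2) y ∓ √(S (n-2) y ^ 2 + 4)) / 2`, with the `-` sign iff `n ≡ 0 (mod 3)`. -/
noncomputable def rD (S : ℤ → ℝ → ℝ) (n : ℕ) (y : ℝ) : ℝ :=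
  if n % 3 = 0 then (S ((n : ℤ) - 2) y - Real.sqrt (S ((n : ℤ) - 2) y ^ 2 + 4)) / 2
  else (S ((n : ℤ) - 2) y + Real.sqrt (S ((n : ℤ) - 2) y ^ 2 + 4)) / 2

/-- `z_ε = ε * √(1 + r (S (n-2) y - S (n-3) y))`, where `ε = ±1` selects `z_±`. -/
noncomputable def zD (S : ℤ → ℝ → ℝ) (n : ℕ) (ε y : ℝ) : ℝ :=
  ε * Real.sqrt (1 + rD S n y * (S ((n : ℤ) - 2) y - S ((n : ℤ) - 3) y))

/-- `x_ε = z_ε * (y + 1 - (S (n-3) y + r)/S (n-2) y)`, where `ε = ±1` selects `x_±`. -/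
noncomputable def xD (S : ℤ → ℝ → ℝ) (n : ℕ) (ε y : ℝ) : ℝ :=
  zD S n ε y * (y + 1 - (S ((n : ℤ) - 3) y + rD S n y) / S ((n : ℤ) - 2) y)

/-- The values at `2 cos θ` of a sequence satisfying the Chebyshev recurrence. -/
lemma chebyshev_mul_sin (S : ℤ → ℝ → ℝ) (hS0 : ∀ y : ℝ, S 0 y = 1) (hS1 : ∀ y : ℝ, S 1 y = y)
    (hSrec : ∀ (k : ℤ) (y : ℝ), S k y = y * S (k - 1) y - S (k - 2) y) (θ : ℝ) (k : ℕ) :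
    S k (2 * cos θ) * sin θ = sin (((k : ℝ) + 1) * θ) := by
  induction k using Nat.twoStepInduction with
  | zero => simp [hS0]
  | one =>
    have h : (((1 : ℕ) : ℝ) + 1) * θ = 2 * θ := by push_cast; ring
    rw [h, sin_two_mul, Nat.cast_one, hS1]
    ring
  | more k ih₀ ih₁ =>
    rw [hSrec]
    have e₁ : (((k + 2 : ℕ) : ℤ) - 1) = ((k + 1 : ℕ) : ℤ) := by push_cast; ring
    have e₂ : (((k + 2 : ℕ) : ℤ) - 2) = (k : ℤ) := by push_cast; ring
    have f₁ : (((k + 2 : ℕ) : ℝ) + 1) * θ = (((k + 1 : ℕ) : ℝ) + 1) * θ + θ := by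
      push_cast; ring
    have f₂ : ((k : ℝ) + 1) * θ = (((k + 1 : ℕ) : ℝ) + 1) * θ - θ := by push_cast; ring
    rw [f₂, sin_sub] at ih₀
    rw [e₁, e₂, f₁, sin_add]
    linear_combination 2 * cos θ * ih₁ - ih₀

lemma FN_mul_two_sin (n : ℕ) (θ : ℝ) :
    2 * sin (θ / 2) * FN n θ =
      sin (n * θ) * ((2 * cos θ - 1) * ((2 * cos θ) ^ 2 - 3))
        - sin (((n : ℝ) - 1) * θ) * ((2 * cos θ) ^ 2 - 2 * cos θ - 1) := by
  obtain ⟨h, rfl⟩ : ∃ h, θ = 2 * h := ⟨θ / 2, by ring⟩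
  unfold FN
  have e₁ : ((n : ℝ) + 1) * (2 * h) = n * (2 * h) + 2 * h := by ring
  have e₂ : 3 * (2 * h) / 2 = 3 * h := by ring
  have e₃ : (2 * (n : ℝ) + 1) * (2 * h) / 2 = n * (2 * h) + h := by ring
  have e₄ : ((n : ℝ) - 1) * (2 * h) = n * (2 * h) - 2 * h := by ring
  have e₅ : 2 * h / 2 = h := by ring
  rw [e₁, e₂, e₃, e₄, e₅]
  generalize (n : ℝ) * (2 * h) = u
  rw [cos_add, cos_add, sin_sub, cos_three_mul, cos_two_mul, sin_two_mul]
  have hs : sin h ^ 2 = 1 - cos h ^ 2 := by rw [sin_sq]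
  grind

lemma one_add_mul_sub_nonneg {a b c y r : ℝ} (ha : 0 < a) (hnorm : a ^ 2 + c ^ 2 - y * a * c = 1)
    (hb : b = y * a - c) (hr : r ^ 2 = a * r + 1) (hr0 : 0 < r) (hy : y ≤ 0) :
    0 ≤ 1 + r * (a - b) := by
  have hbr : b ≤ r := by
    by_contra! h
    have hb0 : 0 < b := hr0.trans h
    have h₁ : b ^ 2 - a * b - 1 = -a ^ 2 + (y - 1) * (a * b) := by
      subst hb
      linear_combination hnorm
    have h₂ : 0 < (b - r) * (b + r - a) := by
      refine mul_pos (by linarith) ?_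
      have : a < r := by nlinarith
      linarith
    nlinarith [mul_pos ha hb0]
  nlinarith

lemma sq_mul_one_add_lt_sq {a b c y r : ℝ} (ha : 0 < a) (hnorm : a ^ 2 + c ^ 2 - y * a * c = 1)
    (hb : b = y * a - c) (hr : r ^ 2 = a * r + 1) (hr0 : 0 < r) (hc : 2 * c ≤ a)
    (hβ : 0 < a + (1 - y) * c) (hy : y ≤ 0) (hy' : -(3 / 2) < y) :
    c ^ 2 * (1 + r * (a - b)) < a ^ 2 := by
  obtain ⟨t, rfl⟩ : ∃ t, c = a * t := ⟨c / a, by field_simp⟩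
  have ht : t ≤ 1 / 2 := by nlinarith
  have hβt : 0 < 1 + (1 - y) * t := by
    have : a + (1 - y) * (a * t) = a * (1 + (1 - y) * t) := by ring
    rw [this] at hβ
    exact pos_of_mul_pos_right hβ ha.le
  have ht' : -1 < t := by
    by_contra! h
    nlinarith
  have hQ : 0 < 1 - t - t ^ 2 - t ^ 4 + y * t ^ 3 := by
    rcases le_total 0 t with h | h
    · have h₂ : t ^ 2 ≤ 1 / 4 := by nlinarith
      have h₃ : t ^ 3 ≤ 1 / 8 := by nlinarith
      have h₄ : t ^ 4 ≤ 1 / 16 := by nlinarith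
      have h₀ : 0 ≤ t ^ 3 := by positivity
      nlinarith
    · have h₂ : t ^ 2 ≤ -t := by nlinarith
      have h₄ : t ^ 4 < 1 := by nlinarith [sq_nonneg t]
      have h₃ : 0 ≤ y * t ^ 3 := mul_nonneg_of_nonpos_of_nonpos hy (by
        nlinarith [sq_nonneg t])
      linarith
  set g := a ^ 2 - (a * t) ^ 2 with hg
  set k := (a * t) ^ 2 * (a - b) with hk
  have hg0 : 0 < g := by
    have : g = a ^ 2 * ((1 - t) * (1 + t)) := by rw [hg]; ring
    rw [this]
    have : 0 < 1 - t := by linarith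
    have : 0 < 1 + t := by linarith
    positivity
  have hP : 0 < g ^ 2 - a * g * k - k ^ 2 := by
    have : g ^ 2 - a * g * k - k ^ 2
        = a ^ 6 * ((1 + (1 - y) * t) * (1 - t - t ^ 2 - t ^ 4 + y * t ^ 3)) := by
      rw [hg, hk, hb]
      linear_combination (-(a ^ 4 * (1 - t ^ 2) ^ 2)) * hnorm
    rw [this]
    positivity
  have hmain : 0 < g - r * k := by
    by_contra! h
    have hk0 : 0 < k := by
      by_contra! hk0
      nlinarith
    have h₁ : 0 ≤ (r * k - g) * (g + (r - a) * k) := by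
      have : 0 < r - a := by
        by_contra! h
        nlinarith
      exact mul_nonneg (by linarith) (by positivity)
    nlinarith [sq_nonneg k]
  nlinarith

lemma mul_sub_eq {a b c y r z : ℝ} (ha : a ≠ 0) (hnorm : a ^ 2 + c ^ 2 - y * a * c = 1)
    (hb : b = y * a - c) (hr : r ^ 2 = a * r + 1) (hz : z ^ 2 = 1 + r * (a - b)) :
    z * (y + 1 - (b + r) / a) * z - y - 1 = r * (c - r) := by
  obtain ⟨w, hw⟩ : ∃ w, w = y + 1 - (b + r) / a := ⟨_, rfl⟩
  have haw : a * w = a + c - r := by rw [hw, hb]; field_simp; ring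
  rw [← hw]
  apply mul_left_cancel₀ ha
  have hn : a ^ 2 - b * c = 1 := by rw [hb]; linear_combination hnorm
  linear_combination a * w * hz + (1 + r * (a - b)) * haw + r * hn + b * hr + hb

lemma sq_mul_sub_eq {a b c y r z : ℝ} (ha : a ≠ 0) (hnorm : a ^ 2 + c ^ 2 - y * a * c = 1)
    (hb : b = y * a - c) (hr : r ^ 2 = a * r + 1) (hz : z ^ 2 = 1 + r * (a - b)) :
    a * ((z * (y + 1 - (b + r) / a)) ^ 2 * z - z * (y + 1 - (b + r) / a) * y - z)
      = z * c * (r * (c - r)) := by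
  have hD := mul_sub_eq ha hnorm hb hr hz
  obtain ⟨w, hw⟩ : ∃ w, w = y + 1 - (b + r) / a := ⟨_, rfl⟩
  have haw : a * w = a + c - r := by rw [hw, hb]; field_simp; ring
  rw [← hw] at hD ⊢
  linear_combination a * z * w * hD + z * (r * (c - r) + 1) * haw + z * (r - c) * hr

lemma sq_sub_sq_pos {a b c y r z : ℝ} (ha : 0 < a) (hnorm : a ^ 2 + c ^ 2 - y * a * c = 1)
    (hb : b = y * a - c) (hr : r ^ 2 = a * r + 1) (hr0 : 0 < r) (hc : 2 * c ≤ a)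
    (hβ : 0 < a + (1 - y) * c) (hy : y ≤ 0) (hy' : -(3 / 2) < y)
    (hz : z ^ 2 = 1 + r * (a - b)) :
    0 < (z * (y + 1 - (b + r) / a) * z - y - 1) ^ 2
      - ((z * (y + 1 - (b + r) / a)) ^ 2 * z - z * (y + 1 - (b + r) / a) * y - z) ^ 2 := by
  have hC := sq_mul_sub_eq ha.ne' hnorm hb hr hz
  have hlt := sq_mul_one_add_lt_sq ha hnorm hb hr hr0 hc hβ hy hy'
  rw [← hz] at hlt
  rw [mul_sub_eq ha.ne' hnorm hb hr hz]
  generalize (z * (y + 1 - (b + r) / a)) ^ 2 * z - z * (y + 1 - (b + r) / a) * y - z = C at hC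
  have hcr : c < r := by
    have : a < r := by nlinarith
    linarith
  have hD : 0 < (r * (c - r)) ^ 2 := by
    have : r * (c - r) ≠ 0 := mul_ne_zero hr0.ne' (by linarith)
    positivity
  have h : 0 < a ^ 2 * ((r * (c - r)) ^ 2 - C ^ 2) := by
    have : a ^ 2 * ((r * (c - r)) ^ 2 - C ^ 2)
        = (r * (c - r)) ^ 2 * (a ^ 2 - c ^ 2 * z ^ 2) := by
      linear_combination (-(a * C) - z * c * (r * (c - r))) * hC
    rw [this]
    exact mul_pos hD (by linarith)
  exact pos_of_mul_pos_right h (by positivity)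

/-- The bound `2 * -sin B ≤ sin A` persists when `A` and `B` increase: here `A` and `B` stand for
phases such that, up to a common sign, `sin ((n-1)θ) = sin A` and `sin (nθ) = -sin B`. -/
lemma two_mul_neg_sin_le {A₁ A B₁ B : ℝ} (hA₁ : -(π / 2) ≤ A₁) (hA : A₁ ≤ A)
    (hA' : 0 ≤ B ∨ A ≤ π / 2) (hA0 : 0 < sin A)
    (hB₁ : -(π / 2) ≤ B₁) (hB : B₁ ≤ B) (hB' : B ≤ π / 2)
    (h : 2 * -sin B₁ ≤ sin A₁) : 2 * -sin B ≤ sin A := by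
  rcases hA' with hB0 | hA'
  · have : 0 ≤ sin B := sin_nonneg_of_nonneg_of_le_pi hB0 (by linarith [pi_pos])
    linarith
  · have := sin_le_sin_of_le_of_le_pi_div_two hA₁ hA' hA
    have := sin_le_sin_of_le_of_le_pi_div_two hB₁ hB' hB
    linarith

lemma sin_cos_phases_zero (m : ℕ) (δ : ℝ) :
    -sin (((3 * m : ℕ) - 1 : ℝ) * (2 * π / 3 + δ)) = sin (π / 3 + (3 * m * δ - δ)) ∧
    sin ((3 * m : ℕ) * (2 * π / 3 + δ)) = sin (3 * m * δ) ∧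
    cos ((2 * (3 * m : ℕ) + 1 : ℝ) * (2 * π / 3 + δ) / 2) = cos (π / 3 + (3 * m * δ + δ / 2)) := by
  push_cast
  refine ⟨?_, ?_, ?_⟩
  · have : (3 * (m : ℝ) - 1) * (2 * π / 3 + δ)
        = (π / 3 + (3 * m * δ - δ) - π) + m * (2 * π) := by ring
    rw [this, sin_add_nat_mul_two_pi, sin_sub_pi, neg_neg]
  · have : 3 * (m : ℝ) * (2 * π / 3 + δ) = 3 * m * δ + m * (2 * π) := by ring
    rw [this, sin_add_nat_mul_two_pi]
  · have : (2 * (3 * (m : ℝ)) + 1) * (2 * π / 3 + δ) / 2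
        = π / 3 + (3 * m * δ + δ / 2) + m * (2 * π) := by ring
    rw [this, cos_add_nat_mul_two_pi]

lemma sin_cos_phases_one (m : ℕ) (δ : ℝ) :
    sin (((3 * m + 1 : ℕ) - 1 : ℝ) * (2 * π / 3 + δ)) = sin (3 * m * δ) ∧
    sin ((3 * m + 1 : ℕ) * (2 * π / 3 + δ)) = -sin (3 * m * δ + δ - π / 3) ∧
    cos ((2 * (3 * m + 1 : ℕ) + 1 : ℝ) * (2 * π / 3 + δ) / 2)
      = -cos (3 * m * δ + 3 * δ / 2) := by
  push_cast
  refine ⟨?_, ?_, ?_⟩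
  · have : (3 * (m : ℝ) + 1 - 1) * (2 * π / 3 + δ) = 3 * m * δ + m * (2 * π) := by ring
    rw [this, sin_add_nat_mul_two_pi]
  · have : (3 * (m : ℝ) + 1) * (2 * π / 3 + δ)
        = (3 * m * δ + δ - π / 3 + π) + m * (2 * π) := by ring
    rw [this, sin_add_nat_mul_two_pi, sin_add_pi]
  · have : (2 * (3 * (m : ℝ) + 1) + 1) * (2 * π / 3 + δ) / 2
        = (3 * m * δ + 3 * δ / 2 + π) + m * (2 * π) := by ring
    rw [this, cos_add_nat_mul_two_pi, cos_add_pi]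

lemma sin_cos_phases_two (m : ℕ) (δ : ℝ) :
    sin (((3 * m + 2 : ℕ) - 1 : ℝ) * (2 * π / 3 + δ)) = sin (2 * π / 3 + (3 * m * δ + δ)) ∧
    sin ((3 * m + 2 : ℕ) * (2 * π / 3 + δ)) = -sin (π / 3 + (3 * m * δ + 2 * δ)) ∧
    cos ((2 * (3 * m + 2 : ℕ) + 1 : ℝ) * (2 * π / 3 + δ) / 2)
      = -cos (2 * π / 3 + (3 * m * δ + 5 * δ / 2)) := by
  push_cast
  refine ⟨?_, ?_, ?_⟩
  · have : (3 * (m : ℝ) + 2 - 1) * (2 * π / 3 + δ)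
        = 2 * π / 3 + (3 * m * δ + δ) + m * (2 * π) := by ring
    rw [this, sin_add_nat_mul_two_pi]
  · have : (3 * (m : ℝ) + 2) * (2 * π / 3 + δ)
        = (π / 3 + (3 * m * δ + 2 * δ) + π) + m * (2 * π) := by ring
    rw [this, sin_add_nat_mul_two_pi, sin_add_pi]
  · have : (2 * (3 * (m : ℝ) + 2) + 1) * (2 * π / 3 + δ) / 2
        = (2 * π / 3 + (3 * m * δ + 5 * δ / 2) + π) + m * (2 * π) := by ring
    rw [this, cos_add_nat_mul_two_pi, cos_add_pi]

/-- The sign of `S (n-2) y` on the interval. -/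
noncomputable def signN (n : ℕ) : ℝ := if n % 3 = 0 then -1 else 1

lemma signN_mul_mod_three_zero (n m : ℕ) (hm : n = 3 * m) (hm1 : (1 : ℝ) ≤ m)
    (δ₁ δ : ℝ) (h₁' : δ₁ ≤ δ)
    (hα : alphaN n ≤ 2 * π / 3 + δ₁) (hβ : 2 * π / 3 + δ < betaN n) :
    0 < signN n * sin (((n : ℝ) - 1) * (2 * π / 3 + δ)) ∧
    signN n * cos ((2 * (n : ℝ) + 1) * (2 * π / 3 + δ) / 2) < 0 ∧
    (2 * (signN n * sin (n * (2 * π / 3 + δ₁)))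
        ≤ signN n * sin (((n : ℝ) - 1) * (2 * π / 3 + δ₁)) →
      2 * (signN n * sin (n * (2 * π / 3 + δ)))
        ≤ signN n * sin (((n : ℝ) - 1) * (2 * π / 3 + δ))) := by
  have hpi := pi_pos
  have hmδ : (m : ℝ) * δ₁ ≤ m * δ := by gcongr
  have hs : signN n = -1 := by simp [signN, hm]
  have hα' : -(π / (6 * (n : ℝ) + 15)) ≤ δ₁ := by
    simp only [alphaN, hm, Nat.mul_mod_right, if_true] at hα ⊢; linarith
  have hβ' : δ < π / (6 * (n : ℝ) + 3) := by
    simp only [betaN, hm, Nat.mul_mod_right, if_true] at hβ ⊢; linarith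
  rw [lt_div_iff₀ (by positivity)] at hβ'
  rw [neg_le, le_div_iff₀ (by positivity)] at hα'
  obtain ⟨p₁, p₂, p₃⟩ := sin_cos_phases_zero m δ
  obtain ⟨q₁, q₂, -⟩ := sin_cos_phases_zero m δ₁
  rw [hs]
  subst hm
  push_cast at *
  simp only [neg_one_mul]
  rw [p₁, p₂, p₃, q₁, q₂]
  have l₁ : -(π / 6) ≤ 3 * m * δ₁ - δ₁ ∧ -(π / 2) ≤ 3 * m * δ₁ := by
    constructor <;> rcases le_total 0 δ₁ with h | h <;> nlinarith
  have l₂ : 3 * m * δ - δ ≤ π / 6 ∧ 3 * m * δ ≤ π / 2 := by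
    constructor <;> rcases le_total 0 δ with h | h <;> nlinarith
  have l₃ : 3 * m * δ₁ - δ₁ ≤ 3 * m * δ - δ := by nlinarith
  have l₄ : -(π / 2) ≤ 3 * m * δ₁ + δ₁ / 2 := by
    rcases le_total 0 δ₁ with h | h <;> nlinarith
  have hA0 : 0 < sin (π / 3 + (3 * m * δ - δ)) :=
    sin_pos_of_pos_of_lt_pi (by linarith) (by linarith)
  refine ⟨hA0, neg_lt_zero.2 (cos_pos_of_mem_Ioo ⟨?_, ?_⟩), fun h => ?_⟩
  · linarith
  · linarith
  · exact two_mul_neg_sin_le (by linarith) (by linarith) (Or.inr (by linarith)) hA0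
      l₁.2 (by linarith) l₂.2 h

lemma signN_mul_mod_three_one (n m : ℕ) (hm : n = 3 * m + 1) (hm1 : (1 : ℝ) ≤ m)
    (δ₁ δ : ℝ) (h₁' : δ₁ ≤ δ)
    (hα : alphaN n ≤ 2 * π / 3 + δ₁) (hβ : 2 * π / 3 + δ < betaN n) :
    0 < signN n * sin (((n : ℝ) - 1) * (2 * π / 3 + δ)) ∧
    signN n * cos ((2 * (n : ℝ) + 1) * (2 * π / 3 + δ) / 2) < 0 ∧
    (2 * (signN n * sin (n * (2 * π / 3 + δ₁)))
        ≤ signN n * sin (((n : ℝ) - 1) * (2 * π / 3 + δ₁)) →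
      2 * (signN n * sin (n * (2 * π / 3 + δ)))
        ≤ signN n * sin (((n : ℝ) - 1) * (2 * π / 3 + δ))) := by
  have hpi := pi_pos
  have hmδ : (m : ℝ) * δ₁ ≤ m * δ := by gcongr
  have hs : signN n = 1 := by simp [signN, hm]
  have hmod : (3 * m + 1) % 3 = 1 := by omega
  have hα' : π / (6 * (n : ℝ) - 3) ≤ δ₁ := by
    simp only [alphaN, hm, hmod, one_ne_zero, if_true, if_false] at hα ⊢; linarith
  have hβ' : δ < π / (2 * (n : ℝ) + 1) := by
    simp only [betaN, hm, hmod, one_ne_zero, if_true, if_false] at hβ ⊢; linarith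
  have hn' : (3 : ℝ) ≤ n := by rw [hm]; push_cast; linarith
  rw [lt_div_iff₀ (by positivity)] at hβ'
  rw [div_le_iff₀ (by linarith)] at hα'
  obtain ⟨p₁, p₂, p₃⟩ := sin_cos_phases_one m δ
  obtain ⟨q₁, q₂, -⟩ := sin_cos_phases_one m δ₁
  rw [hs]
  subst hm
  push_cast at *
  simp only [one_mul]
  rw [p₁, p₂, p₃, q₁, q₂]
  have hδ₁ : 0 < δ₁ := by
    by_contra! h
    nlinarith
  have hδ : 0 < δ := by linarith
  have hmδ₁ : 0 < m * δ₁ := by positivity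
  have hA0 : 0 < sin (3 * m * δ) := sin_pos_of_pos_of_lt_pi (by linarith) (by linarith)
  refine ⟨hA0, neg_lt_zero.2 (cos_pos_of_mem_Ioo ⟨?_, ?_⟩), fun h => ?_⟩
  · linarith
  · linarith
  · exact two_mul_neg_sin_le (by linarith) (by linarith) (Or.inr (by linarith)) hA0
      (by linarith) (by linarith) (by linarith) h

lemma signN_mul_mod_three_two (n m : ℕ) (hm : n = 3 * m + 2) (hm1 : (1 : ℝ) ≤ m)
    (δ₁ δ : ℝ) (h₁' : δ₁ ≤ δ)
    (hα : alphaN n ≤ 2 * π / 3 + δ₁) (hβ : 2 * π / 3 + δ < betaN n) :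
    0 < signN n * sin (((n : ℝ) - 1) * (2 * π / 3 + δ)) ∧
    signN n * cos ((2 * (n : ℝ) + 1) * (2 * π / 3 + δ) / 2) < 0 ∧
    (2 * (signN n * sin (n * (2 * π / 3 + δ₁)))
        ≤ signN n * sin (((n : ℝ) - 1) * (2 * π / 3 + δ₁)) →
      2 * (signN n * sin (n * (2 * π / 3 + δ)))
        ≤ signN n * sin (((n : ℝ) - 1) * (2 * π / 3 + δ))) := by
  have hpi := pi_pos
  have hmδ : (m : ℝ) * δ₁ ≤ m * δ := by gcongr
  have hs : signN n = 1 := by simp [signN, hm, Nat.add_mod]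
  have hmod : (3 * m + 2) % 3 = 2 := by omega
  have hα' : -(π / (2 * (n : ℝ) + 5)) ≤ δ₁ := by
    simp only [alphaN, hm, hmod, OfNat.ofNat_ne_zero, OfNat.ofNat_ne_one, if_false] at hα ⊢
    linarith
  have hβ' : δ < -(π / (6 * (n : ℝ) + 3)) := by
    simp only [betaN, hm, hmod, OfNat.ofNat_ne_zero, OfNat.ofNat_ne_one, if_false] at hβ ⊢
    linarith
  rw [lt_neg, div_lt_iff₀ (by positivity)] at hβ'
  rw [neg_le, le_div_iff₀ (by positivity)] at hα'
  obtain ⟨p₁, p₂, p₃⟩ := sin_cos_phases_two m δ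
  obtain ⟨q₁, q₂, -⟩ := sin_cos_phases_two m δ₁
  rw [hs]
  subst hm
  push_cast at *
  simp only [one_mul]
  rw [p₁, p₂, p₃, q₁, q₂]
  have hδ : δ < 0 := by
    by_contra! h
    nlinarith
  have hδ₁ : δ₁ < 0 := by linarith
  have hmδ' : m * δ < 0 := by nlinarith
  have hA0 : 0 < sin (2 * π / 3 + (3 * m * δ + δ)) :=
    sin_pos_of_pos_of_lt_pi (by linarith) (by linarith)
  refine ⟨hA0, neg_lt_zero.2 (cos_pos_of_mem_Ioo ⟨?_, ?_⟩), fun h => ?_⟩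
  · linarith
  · linarith
  · refine two_mul_neg_sin_le (by linarith) (by linarith) ?_ hA0
      (by linarith) (by linarith) (by linarith) h
    rcases le_total 0 (π / 3 + (3 * m * δ + 2 * δ)) with h0 | h0
    · exact Or.inl h0
    · right
      nlinarith

lemma signN_mul_sin_cos (n : ℕ) (hn : 3 ≤ n) (θ₁ θ : ℝ) (hα : alphaN n ≤ θ₁) (h₁ : θ₁ ≤ θ)
    (hβ : θ < betaN n) :
    0 < signN n * sin (((n : ℝ) - 1) * θ) ∧
    signN n * cos ((2 * (n : ℝ) + 1) * θ / 2) < 0 ∧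
    (2 * (signN n * sin (n * θ₁)) ≤ signN n * sin (((n : ℝ) - 1) * θ₁) →
      2 * (signN n * sin (n * θ)) ≤ signN n * sin (((n : ℝ) - 1) * θ)) := by
  obtain ⟨δ₁, rfl⟩ : ∃ δ, θ₁ = 2 * π / 3 + δ := ⟨θ₁ - 2 * π / 3, by ring⟩
  obtain ⟨δ, rfl⟩ : ∃ δ, θ = 2 * π / 3 + δ := ⟨θ - 2 * π / 3, by ring⟩
  have h₁' : δ₁ ≤ δ := by linarith
  obtain ⟨m, hm⟩ : ∃ m, n = 3 * m ∨ n = 3 * m + 1 ∨ n = 3 * m + 2 := ⟨n / 3, by omega⟩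
  have hm1 : (1 : ℝ) ≤ m := by exact_mod_cast (show 1 ≤ m by omega)
  rcases hm with hm | hm | hm
  · exact signN_mul_mod_three_zero n m hm hm1 δ₁ δ h₁' hα hβ
  · exact signN_mul_mod_three_one n m hm hm1 δ₁ δ h₁' hα hβ
  · exact signN_mul_mod_three_two n m hm hm1 δ₁ δ h₁' hα hβ

lemma pi_div_two_le_alphaN (n : ℕ) (hn : 3 ≤ n) : π / 2 ≤ alphaN n := by
  have hpi := pi_pos
  have hn' : (3 : ℝ) ≤ n := by exact_mod_cast hn
  unfold alphaN
  split_ifs with h0 h1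
  · have : π / (6 * (n : ℝ) + 15) ≤ π / 6 := by gcongr; linarith
    linarith
  · have : 0 ≤ π / (6 * (n : ℝ) - 3) := div_nonneg hpi.le (by linarith)
    linarith
  · have : π / (2 * (n : ℝ) + 5) ≤ π / 6 := by gcongr; linarith
    linarith

lemma betaN_lt (n : ℕ) (hn : 3 ≤ n) (hn4 : n ≠ 4) : betaN n < 2 * π / 3 + 6 / 25 := by
  have hpi := pi_pos
  have hpi' := pi_lt_d2
  have hn' : (3 : ℝ) ≤ n := by exact_mod_cast hn
  unfold betaN
  split_ifs with h0 h1
  · have : π / (6 * (n : ℝ) + 3) ≤ π / 21 := by gcongr; linarith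
    linarith
  · have h7 : (7 : ℝ) ≤ n := by exact_mod_cast (show 7 ≤ n by omega)
    have : π / (2 * (n : ℝ) + 1) ≤ π / 15 := by gcongr; linarith
    linarith
  · have : 0 ≤ π / (6 * (n : ℝ) + 3) := by positivity
    linarith

lemma gammaN_lt_seven : gammaN 7 < 2 * π / 3 + 7 / 50 := by
  have hpi' := pi_lt_d2
  norm_num [gammaN]
  linarith

lemma gammaN_lt (n : ℕ) (hn : 3 ≤ n) (hn4 : n ≠ 4) (hn7 : n ≠ 7) :
    gammaN n < 2 * π / 3 + 1 / 10 := by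
  have hpi := pi_pos
  have hpi' := pi_lt_d2
  unfold gammaN
  split_ifs with h0 h1
  · linarith
  · have h10 : (10 : ℝ) ≤ n := by exact_mod_cast (show 10 ≤ n by omega)
    have : 4 * π / (12 * (n : ℝ) + 9) ≤ 4 * π / 129 := by gcongr; linarith
    linarith
  · have : 0 ≤ 4 * π / (12 * (n : ℝ) + 9) := by positivity
    linarith

lemma neg_half_sub_le_cos {θ d : ℝ} (hθ : 0 ≤ θ) (hd : 0 ≤ d) (hd' : d ≤ 1)
    (h : θ ≤ 2 * π / 3 + d) : -(1 / 2) - d ≤ cos θ := by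
  have h₁ : cos (2 * π / 3 + d) ≤ cos θ :=
    cos_le_cos_of_nonneg_of_le_pi hθ (by linarith [pi_gt_three]) h
  have h₂ : |cos (2 * π / 3 + d) - cos (2 * π / 3)| ≤ |2 * π / 3 + d - 2 * π / 3| :=
    abs_cos_sub_cos_le _ _
  have h₃ : cos (2 * π / 3) = -(1 / 2) := by
    rw [show 2 * π / 3 = π - π / 3 by ring, cos_pi_sub, cos_pi_div_three]
  rw [add_sub_cancel_left, abs_of_nonneg hd, h₃] at h₂
  linarith [neg_abs_le (cos (2 * π / 3 + d) - -(1 / 2))]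

lemma two_mul_le_of_FN_eq_zero {a c y : ℝ} (ha : 0 ≤ a) (hy : y ≤ 0) (hy' : -(6 / 5) ≤ y)
    (h : c * ((y - 1) * (y ^ 2 - 3)) = a * (y ^ 2 - y - 1)) : 2 * c ≤ a := by
  have hq : 0 < (y - 1) * (y ^ 2 - 3) := mul_pos_of_neg_of_neg (by linarith) (by nlinarith)
  have h₁ : 0 ≤ (a - 2 * c) * ((y - 1) * (y ^ 2 - 3)) := by
    have : (a - 2 * c) * ((y - 1) * (y ^ 2 - 3)) = a * (y ^ 3 - 3 * y ^ 2 - y + 5) := by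
      linear_combination (-2) * h
    rw [this]
    refine mul_nonneg ha ?_
    nlinarith [sq_nonneg y, mul_nonneg (mul_nonneg (neg_nonneg.2 hy) (neg_nonneg.2 hy))
      (by linarith : (0 : ℝ) ≤ y + 6 / 5)]
  have := nonneg_of_mul_nonneg_left h₁ hq
  linarith

lemma two_mul_chebyshev_six_le {S : ℤ → ℝ → ℝ} (hS0 : ∀ y : ℝ, S 0 y = 1)
    (hS1 : ∀ y : ℝ, S 1 y = y)
    (hSrec : ∀ (k : ℤ) (y : ℝ), S k y = y * S (k - 1) y - S (k - 2) y) {y : ℝ}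
    (hy : y ≤ -(6 / 5)) (hy' : -(13 / 10) ≤ y) : 2 * S 6 y ≤ S 5 y := by
  have h2 := hSrec 2 y
  have h3 := hSrec 3 y
  have h4 := hSrec 4 y
  have h5 := hSrec 5 y
  have h6 := hSrec 6 y
  norm_num [hS0, hS1] at h2 h3 h4 h5 h6
  rw [h6, h5, h4, h3, h2]
  obtain ⟨u, rfl⟩ : ∃ u, y = -(6 / 5) - u := ⟨-(6 / 5) - y, by ring⟩
  have hu : 0 ≤ u := by linarith
  have hu' : u ≤ 1 / 10 := by linarith
  have hu2 : u ^ 2 ≤ u / 10 := by nlinarith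
  have hu3 : u ^ 3 ≤ u / 100 := by nlinarith
  have hu4 : u ^ 4 ≤ u / 1000 := by nlinarith
  have hu5 : u ^ 5 ≤ u / 10000 := by nlinarith
  have hu6 : u ^ 6 ≤ u / 100000 := by nlinarith
  have : 0 ≤ u ^ 2 := by positivity
  have : 0 ≤ u ^ 3 := by positivity
  have : 0 ≤ u ^ 4 := by positivity
  have : 0 ≤ u ^ 5 := by positivity
  have : 0 ≤ u ^ 6 := by positivity
  ring_nf
  nlinarith

lemma signN_mul_signN (n : ℕ) : signN n * signN n = 1 := by
  unfold signN
  split_ifs <;> norm_num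

lemma signN_mul_rD_pos_and_sq (S : ℤ → ℝ → ℝ) (n : ℕ) (y : ℝ) :
    0 < signN n * rD S n y ∧ rD S n y ^ 2 = S ((n : ℤ) - 2) y * rD S n y + 1 := by
  have h₀ : 0 ≤ S ((n : ℤ) - 2) y ^ 2 + 4 := by positivity
  have h₁ := sq_sqrt h₀
  have h₂ : |S ((n : ℤ) - 2) y| < √(S ((n : ℤ) - 2) y ^ 2 + 4) := by
    rw [← sqrt_sq_eq_abs]
    exact sqrt_lt_sqrt (sq_nonneg _) (by linarith)
  obtain ⟨h₃, h₄⟩ := abs_lt.1 h₂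
  unfold signN rD
  split_ifs <;> constructor <;> nlinarith

/-- Proposition `4`. Let `S k` be the Chebyshev polynomials of the
second kind (`S 0 y = 1`, `S 1 y = y`, `S k y = y * S (k-1) y - S (k-2) y` for all
integers `k`). Let `n ≥ 3`, `n ≠ 4`, and `θ_n ∈ [α_n, γ_n)` with `F(θ_n) = 0`. For
every `θ ∈ [θ_n, β_n)` and either choice of sign `ε = ±1`, with `y = 2 cos θ`,
`x = x_ε`, `z = z_ε`, `C = x² z - x y - z` and `D = x z - y - 1`, one has
`D² - C² > 0`. -/
theorem D_sq_sub_C_sq_pos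
    (S : ℤ → ℝ → ℝ)
    (hS0 : ∀ y : ℝ, S 0 y = 1)
    (hS1 : ∀ y : ℝ, S 1 y = y)
    (hSrec : ∀ (k : ℤ) (y : ℝ), S k y = y * S (k - 1) y - S (k - 2) y)
    (n : ℕ) (hn : 3 ≤ n) (hn4 : n ≠ 4)
    (θn : ℝ) (hθn : θn ∈ Set.Ico (alphaN n) (gammaN n)) (hFθn : FN n θn = 0) :
    ∀ θ ∈ Set.Ico θn (betaN n), ∀ ε : ℝ, ε = 1 ∨ ε = -1 →
      0 < (xD S n ε (2 * Real.cos θ) * zD S n ε (2 * Real.cos θ) - (2 * Real.cos θ) - 1) ^ 2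
          - (xD S n ε (2 * Real.cos θ) ^ 2 * zD S n ε (2 * Real.cos θ)
              - xD S n ε (2 * Real.cos θ) * (2 * Real.cos θ)
              - zD S n ε (2 * Real.cos θ)) ^ 2 := by
  rintro θ ⟨hθ₁, hθ₂⟩ ε hε
  obtain ⟨hα, hγ⟩ := hθn
  have hpi := pi_pos
  have hα' := pi_div_two_le_alphaN n hn
  have hβ' := betaN_lt n hn hn4
  have hθ_pi : θ < π := by linarith [pi_gt_three]
  have hsinn : 0 < sin θn :=
    sin_pos_of_pos_of_lt_pi (by linarith) (by linarith [pi_gt_three])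
  have hsin : 0 < sin θ := sin_pos_of_pos_of_lt_pi (by linarith) hθ_pi
  have hy : 2 * cos θ ≤ 0 := by
    linarith [cos_nonpos_of_pi_div_two_le_of_le (x := θ) (by linarith) (by linarith)]
  have hyn : 2 * cos θn ≤ 0 := by
    linarith [cos_nonpos_of_pi_div_two_le_of_le (x := θn) (by linarith) (by linarith)]
  have hy' : -(3 / 2) < 2 * cos θ := by
    linarith [neg_half_sub_le_cos (θ := θ) (d := 6 / 25) (by linarith) (by norm_num)
      (by norm_num) (by linarith)]
  obtain ⟨hA, hE, hmono⟩ := signN_mul_sin_cos n hn θn θ hα hθ₁ hθ₂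
  obtain ⟨hAn, -, -⟩ := signN_mul_sin_cos n hn θn θn hα le_rfl (hθ₁.trans_lt hθ₂)
  have hS : ∀ t : ℝ, S ((n : ℤ) - 1) (2 * cos t) * sin t = sin (n * t) ∧
      S ((n : ℤ) - 2) (2 * cos t) * sin t = sin (((n : ℝ) - 1) * t) := by
    intro t
    obtain ⟨k, rfl⟩ : ∃ k, n = k + 2 := ⟨n - 2, by omega⟩
    have h₁ := chebyshev_mul_sin S hS0 hS1 hSrec t (k + 1)
    have h₂ := chebyshev_mul_sin S hS0 hS1 hSrec t k
    have e₁ : ((k + 2 : ℕ) : ℤ) - 1 = ((k + 1 : ℕ) : ℤ) := by push_cast; ring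
    have e₂ : ((k + 2 : ℕ) : ℤ) - 2 = (k : ℤ) := by push_cast; ring
    rw [e₁, e₂, h₁, h₂]
    constructor <;> congr 1 <;> push_cast <;> ring
  have hstart : 2 * (signN n * sin (n * θn)) ≤ signN n * sin (((n : ℝ) - 1) * θn) := by
    by_cases hyl : -(6 / 5) ≤ 2 * cos θn
    · refine two_mul_le_of_FN_eq_zero hAn.le hyn hyl ?_
      have := FN_mul_two_sin n θn
      rw [hFθn] at this
      linear_combination (-signN n) * this
    · push Not at hyl
      have h7 : n = 7 := by
        by_contra h7
        linarith [gammaN_lt n hn hn4 h7, neg_half_sub_le_cos (θ := θn) (d := 1 / 10)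
          (by linarith) (by norm_num) (by norm_num) (by linarith [gammaN_lt n hn hn4 h7])]
      subst h7
      have h₁ := neg_half_sub_le_cos (θ := θn) (d := 7 / 50)
        (by linarith) (by norm_num) (by norm_num) (by linarith [gammaN_lt_seven])
      have h₂ := two_mul_chebyshev_six_le hS0 hS1 hSrec hyl.le (by linarith)
      obtain ⟨h₃, h₄⟩ := hS θn
      norm_num at h₃ h₄
      norm_num [signN]
      rw [← h₃, ← h₄]
      nlinarith
  have hc := hmono hstart
  obtain ⟨hcS, haS⟩ := hS θ
  have hb : S ((n : ℤ) - 3) (2 * cos θ)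
      = 2 * cos θ * S ((n : ℤ) - 2) (2 * cos θ) - S ((n : ℤ) - 1) (2 * cos θ) := by
    have h := hSrec ((n : ℤ) - 1) (2 * cos θ)
    rw [show (n : ℤ) - 1 - 1 = n - 2 by ring, show (n : ℤ) - 1 - 2 = n - 3 by ring] at h
    linarith
  obtain ⟨hr0, hr⟩ := signN_mul_rD_pos_and_sq S n (2 * cos θ)
  have hσ := signN_mul_signN n
  have hz : zD S n ε (2 * cos θ) ^ 2 = ε ^ 2 * √(1 + rD S n (2 * cos θ) *
      (S ((n : ℤ) - 2) (2 * cos θ) - S ((n : ℤ) - 3) (2 * cos θ))) ^ 2 := by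
    rw [zD, mul_pow]
  have hε2 : ε ^ 2 = 1 := by rcases hε with rfl | rfl <;> norm_num
  rw [hε2, one_mul] at hz
  unfold xD
  have hnorm : S ((n : ℤ) - 2) (2 * cos θ) ^ 2 + S ((n : ℤ) - 1) (2 * cos θ) ^ 2
      - 2 * cos θ * S ((n : ℤ) - 2) (2 * cos θ) * S ((n : ℤ) - 1) (2 * cos θ) = 1 := by
    have e : (n : ℝ) * θ = ((n : ℝ) - 1) * θ + θ := by ring
    rw [e, sin_add, ← haS] at hcS
    have h₁ := sin_sq_add_cos_sq (((n : ℝ) - 1) * θ)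
    rw [← haS] at h₁
    have h₂ := sin_sq_add_cos_sq θ
    have h₃ : S ((n : ℤ) - 1) (2 * cos θ)
        = S ((n : ℤ) - 2) (2 * cos θ) * cos θ + cos (((n : ℝ) - 1) * θ) := by
      apply mul_right_cancel₀ hsin.ne'
      linear_combination hcS
    rw [h₃]
    linear_combination h₁ - S ((n : ℤ) - 2) (2 * cos θ) ^ 2 * h₂
  have hE' : 0 < signN n * (S ((n : ℤ) - 2) (2 * cos θ)
      + (1 - 2 * cos θ) * S ((n : ℤ) - 1) (2 * cos θ)) := by
    have hc2 : 0 < 2 * sin (θ / 2) := by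
      linarith [sin_pos_of_pos_of_lt_pi (x := θ / 2) (by linarith) (by linarith)]
    have h₁ : (S ((n : ℤ) - 2) (2 * cos θ) + (1 - 2 * cos θ) * S ((n : ℤ) - 1) (2 * cos θ))
        * sin θ = -(2 * sin (θ / 2) * cos ((2 * (n : ℝ) + 1) * θ / 2)) := by
      rw [show (2 * (n : ℝ) + 1) * θ / 2 = n * θ + θ / 2 by ring, cos_add]
      have e : ((n : ℝ) - 1) * θ = n * θ - θ := by ring
      rw [e, sin_sub] at haS
      have h₂ : sin θ = 2 * sin (θ / 2) * cos (θ / 2) := by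
        rw [← sin_two_mul]; congr 1; ring
      have h₃ : cos θ = 1 - 2 * sin (θ / 2) ^ 2 := by
        have := cos_two_mul (θ / 2)
        rw [cos_sq', show 2 * (θ / 2) = θ by ring] at this
        linarith
      linear_combination haS + (1 - 2 * cos θ) * hcS - cos (n * θ) * h₂ - sin (n * θ) * h₃
    refine pos_of_mul_pos_left (b := sin θ) ?_ hsin.le
    rw [mul_assoc, h₁]
    nlinarith
  rw [← haS] at hA hc
  rw [← hcS] at hc
  generalize zD S n ε (2 * cos θ) = z at *
  generalize rD S n (2 * cos θ) = r at *
  generalize S ((n : ℤ) - 1) (2 * cos θ) = c at *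
  generalize S ((n : ℤ) - 2) (2 * cos θ) = a at *
  generalize S ((n : ℤ) - 3) (2 * cos θ) = b at *
  generalize 2 * cos θ = y at *
  generalize signN n = σ at *
  have ha : 0 < σ * a := by
    refine pos_of_mul_pos_left (b := sin θ) ?_ hsin.le
    linarith
  have hc' : 2 * (σ * c) ≤ σ * a := by
    refine le_of_mul_le_mul_right ?_ hsin
    linarith
  have hσ0 : σ ≠ 0 := by
    rintro rfl
    norm_num at hσ
  have hnorm' : (σ * a) ^ 2 + (σ * c) ^ 2 - y * (σ * a) * (σ * c) = 1 := by
    linear_combination hnorm + (a ^ 2 + c ^ 2 - y * a * c) * hσ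
  have hb' : σ * b = y * (σ * a) - σ * c := by linear_combination σ * hb
  have hr' : (σ * r) ^ 2 = σ * a * (σ * r) + 1 := by
    linear_combination hr + (r ^ 2 - a * r) * hσ
  have hrab : 1 + σ * r * (σ * a - σ * b) = 1 + r * (a - b) := by
    linear_combination r * (a - b) * hσ
  have hz0 := one_add_mul_sub_nonneg ha hnorm' hb' hr' hr0 hy
  rw [hrab] at hz0
  rw [sq_sqrt hz0, ← hrab] at hz
  have := sq_sub_sq_pos ha hnorm' hb' hr' hr0 hc' (by linarith) hy hy' hz
  rwa [← mul_add, mul_div_mul_left _ _ hσ0] at this
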